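/- arXiv:1606.07476 — 2 statements merged into one kernel-verified Lean document; each statement's English description precedes it below -/
import Mathlib

section
/- Let (X,b,m) be a connected weighted graph satisfying (B) and (M). Then (X,d) is geodesic: for any x,y ∈ X there exists a path γ = (x_0,…,x_k) with x_0 = x, x_k = y and d(x,y) = L(γ). -/
/-! Basic notions for a weighted graph `(X, b, m)`:
`b : X × X → [0,∞)` is a symmetric edge weight, `m : X → (0,∞)` a vertex measure.
Paths, path lengths, the induced path metric `graphDist`, the energy form,
`ℓ²(X,m)`, volumes, inradius and covering radius. -/

variable {X : Type*}

/-- A path in the weighted graph: a nonempty list of vertices with positive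
edge weight between consecutive vertices. -/
def IsPath (b : X → X → ℝ) (γ : List X) : Prop :=
  γ ≠ [] ∧ γ.Chain' fun u v => 0 < b u v

/-- A path from `x` to `y`. -/
def IsPathFrom (b : X → X → ℝ) (γ : List X) (x y : X) : Prop :=
  IsPath b γ ∧ γ.head? = some x ∧ γ.getLast? = some y

/-- The length of a path: the sum of the reciprocals of the edge weights
of its edges. -/
noncomputable def pathLength (b : X → X → ℝ) : List X → ℝ
  | [] => 0
  | [_] => 0
  | u :: v :: rest => 1 / b u v + pathLength b (v :: rest)

/-- The induced path metric: `d(x,y)` is the infimum of the lengths of paths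
from `x` to `y`. -/
noncomputable def graphDist (b : X → X → ℝ) (x y : X) : ℝ :=
  sInf {L | ∃ γ, IsPathFrom b γ x y ∧ L = pathLength b γ}

/-- The energy form `E(f,f) = (1/2) ∑_{x,y} b(x,y) (f(x) - f(y))²`. -/
noncomputable def energy (b : X → X → ℝ) (f : X → ℝ) : ℝ :=
  (1 / 2) * ∑' p : X × X, b p.1 p.2 * (f p.1 - f p.2) ^ 2

/-- The squared norm in `ℓ²(X,m)`. -/
noncomputable def l2norm (m : X → ℝ) (f : X → ℝ) : ℝ := ∑' x, f x ^ 2 * m x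

/-- Membership in `ℓ²(X,m)`. -/
def MemL2 (m : X → ℝ) (f : X → ℝ) : Prop := Summable fun x => f x ^ 2 * m x

/-- The volume of a subset `A ⊆ X`: `vol(A) = ∑_{x ∈ A} m(x)`. -/
noncomputable def vol (m : X → ℝ) (A : Set X) : ℝ := ∑' x : A, m (x : X)

/-- The inradius `Inr(Ω) = sup {r > 0 : ∃ x ∈ Ω, U_r(x) ⊆ Ω}`. -/
noncomputable def inradius (b : X → X → ℝ) (Ω : Set X) : ℝ :=
  sSup {r | 0 < r ∧ ∃ x ∈ Ω, ∀ y, graphDist b x y < r → y ∈ Ω}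

/-- The covering radius `Covr(D) = inf {R > 0 : ⋃_{p ∈ D} B_R(p) = X}`. -/
noncomputable def covRad (b : X → X → ℝ) (D : Set X) : ℝ :=
  sInf {R | 0 < R ∧ ∀ x, ∃ p ∈ D, graphDist b p x ≤ R}

/-- `D` is relatively dense iff its covering radius is finite, i.e. some
`R > 0` works. -/
def RelDense (b : X → X → ℝ) (D : Set X) : Prop :=
  {R : ℝ | 0 < R ∧ ∀ x, ∃ p ∈ D, graphDist b p x ≤ R}.Nonempty

/-- `vol[s] = sup_{x ∈ X} vol(B_s(x))`. -/
noncomputable def supVolBall (b : X → X → ℝ) (m : X → ℝ) (s : ℝ) : ℝ :=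
  ⨆ x : X, vol m {y | graphDist b x y ≤ s}

theorem chain_cons_aux {X : Type*} {b : X → X → ℝ} {u v : X} {l : List X}
    (h : IsPath b (u :: v :: l)) : 0 < b u v ∧ IsPath b (v :: l) := by
  have h2 : List.IsChain (fun u v => 0 < b u v) (u :: v :: l) := h.2
  rw [List.isChain_cons_cons] at h2
  exact ⟨h2.1, by simp, h2.2⟩

theorem pathLength_nonneg_aux {X : Type*} {b : X → X → ℝ} (hb : ∀ x y, 0 ≤ b x y) (l : List X) :
    0 ≤ pathLength b l := by
  induction l with
  | nil => simp [pathLength]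
  | cons u l ih =>
    cases l with
    | nil => simp [pathLength]
    | cons v l =>
      have := hb u v
      simp only [pathLength]
      positivity

theorem length_le_aux {X : Type*} {b : X → X → ℝ} {C : ℝ} (hC : ∀ x y, b x y ≤ C) (l : List X)
    (hl : IsPath b l) : (l.length : ℝ) ≤ C * pathLength b l + 1 := by
  induction l with
  | nil => simp [pathLength]
  | cons u l ih =>
    cases l with
    | nil => simp [pathLength]
    | cons v l =>
      obtain ⟨h1, h2⟩ := chain_cons_aux hl
      have h3 := ih h2
      have h4 : 1 ≤ C * (1 / b u v) := by
        rw [mul_one_div, le_div_iff₀ h1, one_mul]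
        exact hC u v
      rw [List.length_cons]
      push_cast
      simp only [pathLength]
      linarith

theorem finite_aux {X : Type*} {b : X → X → ℝ} (hb : ∀ x y, 0 ≤ b x y)
    (hs : ∀ x, Summable fun y => b x y) (L : ℝ) (n : ℕ) (x : X) :
    {γ : List X | IsPath b γ ∧ γ.head? = some x ∧ γ.length ≤ n ∧ pathLength b γ ≤ L}.Finite := by
  induction n generalizing x with
  | zero =>
    refine Set.Finite.subset Set.finite_empty ?_
    rintro γ ⟨h1, -, h3, -⟩
    exact (h1.1 (List.length_eq_zero_iff.1 (by omega))).elim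
  | succ n ih =>
    have hfin : {v | 0 < b x v ∧ 1 / b x v ≤ L}.Finite := by
      have ht := (hs x).tendsto_cofinite_zero
      have hpos : (0 : ℝ) < 1 / (|L| + 1) := by positivity
      have he := ht.eventually (gt_mem_nhds hpos)
      rw [Filter.eventually_cofinite] at he
      refine he.subset ?_
      rintro v ⟨h1, h2⟩
      simp only [Set.mem_ofPred_eq, not_lt]
      rw [div_le_iff₀ h1] at h2
      rw [div_le_iff₀ (by positivity)]
      nlinarith [le_abs_self L]
    refine Set.Finite.subset ((Set.finite_singleton [x]).union
      (hfin.biUnion fun v _ => (ih v).image (fun l => x :: l))) ?_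
    rintro γ ⟨h1, h2, h3, h4⟩
    match γ, h1, h2, h3, h4 with
    | [], h1, _, _, _ => exact (h1.1 rfl).elim
    | [u], _, h2, _, _ => left; simpa using h2
    | u :: v :: l, h1, h2, h3, h4 =>
      right
      obtain rfl : u = x := by simpa using h2
      obtain ⟨h5, h6⟩ := chain_cons_aux h1
      simp only [pathLength] at h4
      have h7 := pathLength_nonneg_aux hb (v :: l)
      have h8 : 0 < 1 / b u v := by positivity
      simp only [Set.mem_iUnion]
      refine ⟨v, ⟨h5, by linarith⟩, v :: l, ⟨h6, rfl, ?_, by linarith⟩, rfl⟩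
      simp only [List.length_cons] at h3 ⊢
      omega

/-- Proposition 2.1 (d). For a connected weighted graph
satisfying (B) and (M), the space `(X,d)` is geodesic: for any `x, y` there is
a path `γ` from `x` to `y` with `L(γ) = d(x,y)`. -/
theorem statement_4 {X : Type*} [Countable X] [Nonempty X]
    (b : X → X → ℝ) (m : X → ℝ)
    (hb_symm : ∀ x y, b x y = b y x) (hb_nonneg : ∀ x y, 0 ≤ b x y)
    (hb_diag : ∀ x, b x x = 0) (hb_sum : ∀ x, Summable fun y => b x y)
    (hm_pos : ∀ x, 0 < m x)
    (hconn : ∀ x y, ∃ γ, IsPathFrom b γ x y)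
    (hB : BddAbove (Set.range fun x => (∑' y, b x y) / m x))
    (hM : BddAbove (Set.range m)) :
    ∀ x y : X, ∃ γ : List X, IsPathFrom b γ x y ∧ pathLength b γ = graphDist b x y := by
  intro x y
  obtain ⟨D, hD⟩ := hB
  obtain ⟨M, hM⟩ := hM
  have hC : ∀ u v, b u v ≤ |D| * |M| := by
    intro u v
    have h1 : b u v ≤ ∑' y, b u y := (hb_sum u).le_tsum v fun j _ => hb_nonneg u j
    have h2 : (∑' y, b u y) / m u ≤ D := hD ⟨u, rfl⟩
    have h3 : m u ≤ M := hM ⟨u, rfl⟩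
    rw [div_le_iff₀ (hm_pos u)] at h2
    have h4 : D * m u ≤ |D| * |M| :=
      mul_le_mul (le_abs_self D) (h3.trans (le_abs_self M)) (hm_pos u).le (abs_nonneg D)
    linarith
  obtain ⟨γ₀, hγ₀⟩ := hconn x y
  set L := pathLength b γ₀ with hL
  let S : Set (List X) := {γ | IsPathFrom b γ x y ∧ pathLength b γ ≤ L}
  have hS : S.Finite := by
    refine (finite_aux hb_nonneg hb_sum L ⌊|D| * |M| * L + 1⌋₊ x).subset ?_
    rintro γ ⟨⟨h1, h2, h3⟩, h4⟩
    refine ⟨h1, h2, Nat.le_floor ?_, h4⟩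
    have h5 := length_le_aux hC γ h1
    have h6 : |D| * |M| * pathLength b γ ≤ |D| * |M| * L :=
      mul_le_mul_of_nonneg_left h4 (by positivity)
    linarith
  obtain ⟨γ, hγ, hmin⟩ := Set.exists_min_image S (pathLength b) hS ⟨γ₀, hγ₀, le_refl _⟩
  refine ⟨γ, hγ.1, ?_⟩
  have hleast : IsLeast {L | ∃ γ, IsPathFrom b γ x y ∧ L = pathLength b γ} (pathLength b γ) := by
    refine ⟨⟨γ, hγ.1, rfl⟩, ?_⟩
    rintro _ ⟨γ', h', rfl⟩
    by_cases hle : pathLength b γ' ≤ L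
    · exact hmin γ' ⟨h', hle⟩
    · exact hγ.2.trans (not_le.1 hle).le
  exact hleast.csInf_eq.symm
end

section
/- Let (X,b,m) be a connected weighted graph satisfying (B) and (M), and let D ⊂ X be nonempty. Then there exists a Voronoi decomposition of X with centers from D. -/
/-! Basic notions for a weighted graph `(X, b, m)`:
`b : X × X → [0,∞)` is a symmetric edge weight, `m : X → (0,∞)` a vertex measure.
Paths, path lengths, the induced path metric `graphDist`, the energy form,
`ℓ²(X,m)`, volumes, inradius and covering radius. -/

variable {X : Type*}

/-- A Voronoi decomposition of `X` with centers from `D`: a pairwise disjoint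
family `(V_p)_{p ∈ D}` such that
(V1) `p ∈ V_p` and every `x ∈ V_p` is joined to `p` by a path lying in `V_p`
of length `d(p,x)`;
(V2) `d(p,x) ≤ d(q,x)` for all `x ∈ V_p` and `q ∈ D`;
(V3) `⋃_{p ∈ D} V_p = X`. -/
def IsVoronoiDecomp (b : X → X → ℝ) (D : Set X) (V : X → Set X) : Prop :=
  (∀ p ∈ D, ∀ q ∈ D, p ≠ q → Disjoint (V p) (V q)) ∧
  (∀ p ∈ D, p ∈ V p) ∧
  (∀ p ∈ D, ∀ x ∈ V p, ∃ γ : List X, IsPathFrom b γ p x ∧ (∀ z ∈ γ, z ∈ V p) ∧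
      pathLength b γ = graphDist b p x) ∧
  (∀ p ∈ D, ∀ x ∈ V p, ∀ q ∈ D, graphDist b p x ≤ graphDist b q x) ∧
  (⋃ p ∈ D, V p) = Set.univ

theorem isPathFrom_cons {b : X → X → ℝ} {x y p : X} {l : List X} (hxy : 0 < b x y)
    (h : IsPathFrom b l y p) : IsPathFrom b (x :: l) x p ∧
      pathLength b (x :: l) = 1 / b x y + pathLength b l := by
  obtain ⟨⟨hne, hc⟩, hh, hl⟩ := h
  cases l with
  | nil => exact absurd rfl hne
  | cons z t =>
    simp only [List.head?_cons, Option.some.injEq] at hh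
    subst hh
    refine ⟨⟨⟨by simp, List.isChain_cons_cons.2 ⟨hxy, hc⟩⟩, by simp, ?_⟩, rfl⟩
    simpa using hl

theorem isPathFrom_tail {b : X → X → ℝ} {x a y p : X} {l : List X}
    (h : IsPathFrom b (a :: y :: l) x p) : a = x ∧ 0 < b x y ∧ IsPathFrom b (y :: l) y p := by
  obtain ⟨⟨hne, hc⟩, hh, hl⟩ := h
  simp only [List.head?_cons, Option.some.injEq] at hh
  subst hh
  have hc' := List.isChain_cons_cons.1 hc
  refine ⟨rfl, hc'.1, ⟨by simp, hc'.2⟩, rfl, ?_⟩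
  simpa using hl

theorem pathLength_append (b : X → X → ℝ) (u v : X) (l : List X) :
    pathLength b (l ++ [u, v]) = pathLength b (l ++ [u]) + 1 / b u v := by
  induction l with
  | nil => simp [pathLength]
  | cons a t ih =>
    cases t with
    | nil => simp [pathLength]
    | cons c t =>
      simp only [List.cons_append, pathLength] at ih ⊢
      rw [ih]; ring

theorem pathLength_rev (b : X → X → ℝ) (hs : ∀ x y, b x y = b y x) (l : List X) :
    pathLength b l.reverse = pathLength b l := by
  induction l with
  | nil => simp
  | cons a t ih =>
    cases t with
    | nil => simp
    | cons c t =>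
      have h1 : (a :: c :: t).reverse = t.reverse ++ [c, a] := by simp
      have h2 : (c :: t).reverse = t.reverse ++ [c] := by simp
      rw [h1, pathLength_append, ← h2, ih, hs c a, pathLength]; ring

theorem isPathFrom_rev {b : X → X → ℝ} (hs : ∀ x y, b x y = b y x) {l : List X} {x y : X}
    (h : IsPathFrom b l x y) : IsPathFrom b l.reverse y x := by
  obtain ⟨⟨hne, hc⟩, hh, hl⟩ := h
  refine ⟨⟨by simpa using hne, ?_⟩, by simpa using hl, by simpa using hh⟩
  apply List.isChain_reverse.2
  refine List.IsChain.imp ?_ hc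
  intro u v huv
  rw [hs]; exact huv

theorem graphDist_comm' (b : X → X → ℝ) (hs : ∀ x y, b x y = b y x) (x y : X) :
    graphDist b x y = graphDist b y x := by
  unfold graphDist
  congr 1
  ext L
  constructor <;> rintro ⟨γ, h, rfl⟩ <;>
    exact ⟨γ.reverse, isPathFrom_rev hs h, (pathLength_rev b hs γ).symm⟩

theorem pathLength_nonneg' (b : X → X → ℝ) (hb : ∀ x y, 0 ≤ b x y) (l : List X) :
    0 ≤ pathLength b l := by
  induction l with
  | nil => simp [pathLength]
  | cons a t ih =>
    cases t with
    | nil => simp [pathLength]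
    | cons c t =>
      rw [pathLength]
      have := hb a c
      positivity

theorem finite_paths (b : X → X → ℝ) (hb : ∀ x y, 0 ≤ b x y)
    (hsum : ∀ x, Summable fun y => b x y) (c : ℝ)
    (hcb : ∀ x y, 0 < b x y → c ≤ 1 / b x y) (n : ℕ) :
    ∀ (x : X) (R : ℝ), R < n * c →
      {γ : List X | (∃ p, IsPathFrom b γ x p) ∧ pathLength b γ ≤ R}.Finite := by
  induction n with
  | zero =>
    intro x R hR
    convert Set.finite_empty
    ext γ
    simp only [Set.mem_setOf_eq, Set.mem_empty_iff_false, iff_false]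
    rintro ⟨-, h⟩
    have := pathLength_nonneg' b hb γ
    simp at hR
    linarith
  | succ n ih =>
    intro x R hR
    have hfin : {y | 0 < b x y ∧ 1 / b x y ≤ R}.Finite := by
      by_cases hR0 : 0 < R
      · have h1 := (hsum x).tendsto_cofinite_zero
        have h2 := h1.eventually (gt_mem_nhds (show (0:ℝ) < 1 / R by positivity))
        refine Set.Finite.subset (Filter.eventually_cofinite.1 h2) ?_
        rintro y ⟨h0, h1⟩
        simp only [Set.mem_setOf_eq, not_lt]
        exact (one_div_le hR0 h0).2 h1
      · convert Set.finite_empty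
        ext y
        simp only [Set.mem_setOf_eq, Set.mem_empty_iff_false, iff_false]
        rintro ⟨h0, h1⟩
        have : 0 < 1 / b x y := by positivity
        linarith
    have hF := (hfin.biUnion (t := fun y => (fun l => x :: l) ''
      {γ : List X | (∃ p, IsPathFrom b γ y p) ∧ pathLength b γ ≤ R - c})
      (fun y _ => (ih y (R - c) (by push_cast at hR; linarith)).image _)).insert [x]
    refine hF.subset ?_
    rintro γ ⟨⟨p, hp⟩, hL⟩
    match γ, hp, hL with
    | [], hp, _ => exact absurd rfl hp.1.1
    | [a], hp, _ =>
      have := hp.2.1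
      simp only [List.head?_cons, Option.some.injEq] at this
      subst this
      exact Set.mem_insert _ _
    | a :: y :: t, hp, hL =>
      obtain ⟨rfl, hxy, ht⟩ := isPathFrom_tail hp
      right
      rw [pathLength] at hL
      have h0 := pathLength_nonneg' b hb (y :: t)
      have h1 := hcb _ _ hxy
      simp only [Set.mem_iUnion]
      exact ⟨y, ⟨hxy, by linarith⟩, y :: t, ⟨⟨p, ht⟩, by linarith⟩, rfl⟩

theorem exists_min_path (b : X → X → ℝ) (hb : ∀ x y, 0 ≤ b x y)
    (hsum : ∀ x, Summable fun y => b x y) (c : ℝ) (hc : 0 < c)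
    (hcb : ∀ x y, 0 < b x y → c ≤ 1 / b x y)
    (hconn : ∀ x y, ∃ γ, IsPathFrom b γ x y) (D : Set X) (hD : D.Nonempty) (x : X) :
    ∃ p ∈ D, ∃ γ, IsPathFrom b γ x p ∧ ∀ q ∈ D, ∀ γ', IsPathFrom b γ' x q →
      pathLength b γ ≤ pathLength b γ' := by
  obtain ⟨q₀, hq₀⟩ := hD
  obtain ⟨γ₀, hγ₀⟩ := hconn x q₀
  obtain ⟨n, hn⟩ := exists_nat_gt (pathLength b γ₀ / c)
  have hfin := finite_paths b hb hsum c hcb n x (pathLength b γ₀) ((div_lt_iff₀ hc).1 hn)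
  have hfin2 : {γ : List X | (∃ p ∈ D, IsPathFrom b γ x p) ∧
      pathLength b γ ≤ pathLength b γ₀}.Finite :=
    hfin.subset (fun γ h => ⟨⟨h.1.choose, h.1.choose_spec.2⟩, h.2⟩)
  obtain ⟨γ, ⟨⟨p, hp, hγ⟩, hle⟩, hmin⟩ :=
    Set.exists_min_image _ (pathLength b) hfin2 ⟨γ₀, ⟨q₀, hq₀, hγ₀⟩, le_rfl⟩
  refine ⟨p, hp, γ, hγ, fun q hq γ' h' => ?_⟩
  rcases le_total (pathLength b γ') (pathLength b γ₀) with h | h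
  · exact hmin γ' ⟨⟨q, hq, h'⟩, h⟩
  · exact hle.trans h

theorem graphDist_le (b : X → X → ℝ) (hb : ∀ x y, 0 ≤ b x y) {x y : X} {γ : List X}
    (h : IsPathFrom b γ x y) : graphDist b x y ≤ pathLength b γ := by
  refine csInf_le ⟨0, ?_⟩ ⟨γ, h, rfl⟩
  rintro L ⟨γ, -, rfl⟩
  exact pathLength_nonneg' b hb γ

theorem le_graphDist (b : X → X → ℝ) (hconn : ∀ x y, ∃ γ, IsPathFrom b γ x y) {x y : X} {a : ℝ}
    (h : ∀ γ, IsPathFrom b γ x y → a ≤ pathLength b γ) : a ≤ graphDist b x y := by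
  obtain ⟨γ, hγ⟩ := hconn x y
  refine le_csInf ⟨_, γ, hγ, rfl⟩ ?_
  rintro L ⟨γ, h', rfl⟩
  exact h γ h'

theorem graphDist_edge (b : X → X → ℝ) (hb : ∀ x y, 0 ≤ b x y)
    (hconn : ∀ x y, ∃ γ, IsPathFrom b γ x y) {x y q : X} (hxy : 0 < b x y) :
    graphDist b x q ≤ 1 / b x y + graphDist b y q := by
  have : graphDist b x q - 1 / b x y ≤ graphDist b y q := by
    refine le_graphDist b hconn fun γ hγ => ?_
    obtain ⟨h1, h2⟩ := isPathFrom_cons hxy hγ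
    have := graphDist_le b hb h1
    linarith
  linarith

theorem cell_path (b : X → X → ℝ) (hb : ∀ x y, 0 ≤ b x y)
    (hconn : ∀ x y, ∃ γ, IsPathFrom b γ x y) (D : Set X) (f : X → ℕ) (p : X) (γ : List X) :
    ∀ x, IsPathFrom b γ x p → pathLength b γ = graphDist b x p →
      (∀ q ∈ D, graphDist b x p ≤ graphDist b x q) →
      (∀ q ∈ D, graphDist b x q = graphDist b x p → f p ≤ f q) →
      ∀ z ∈ γ, (∀ q ∈ D, graphDist b z p ≤ graphDist b z q) ∧
        (∀ q ∈ D, graphDist b z q = graphDist b z p → f p ≤ f q) := by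
  induction γ with
  | nil => simp
  | cons a t ih =>
    intro x hγ hL h1 h2 z hz
    have hax : a = x := by simpa using hγ.2.1
    subst hax
    rcases List.mem_cons.1 hz with rfl | hz
    · exact ⟨h1, h2⟩
    cases t with
    | nil => simp at hz
    | cons y t =>
      obtain ⟨-, hxy, ht⟩ := isPathFrom_tail hγ
      rw [pathLength] at hL
      have h3 := graphDist_le b hb ht
      have h4 := fun q => graphDist_edge b hb hconn (q := q) hxy
      have h5 := h4 p
      refine ih y ht (by linarith) ?_ ?_ z hz
      · intro q hq
        have := h4 q
        have := h1 q hq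
        linarith
      · intro q hq he
        refine h2 q hq ?_
        have := h4 q
        have := h1 q hq
        linarith

/-- Proposition 3.6, existence. Let `(X,b,m)` be a
connected weighted graph satisfying (B) and (M) and let `D ⊆ X` be nonempty.
Then there exists a Voronoi decomposition of `X` with centers from `D`. -/
theorem statement_9 {X : Type*} [Countable X] [Nonempty X]
    (b : X → X → ℝ) (m : X → ℝ)
    (hb_symm : ∀ x y, b x y = b y x) (hb_nonneg : ∀ x y, 0 ≤ b x y)
    (hb_diag : ∀ x, b x x = 0) (hb_sum : ∀ x, Summable fun y => b x y)
    (hm_pos : ∀ x, 0 < m x)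
    (hconn : ∀ x y, ∃ γ, IsPathFrom b γ x y)
    (hB : BddAbove (Set.range fun x => (∑' y, b x y) / m x))
    (hM : BddAbove (Set.range m))
    (D : Set X) (hD : D.Nonempty) :
    ∃ V : X → Set X, IsVoronoiDecomp b D V := by
  obtain ⟨c, hc, hcb⟩ : ∃ c : ℝ, 0 < c ∧ ∀ x y, 0 < b x y → c ≤ 1 / b x y := by
    obtain ⟨B, hB⟩ := hB
    obtain ⟨M, hM⟩ := hM
    refine ⟨1 / (|B| * |M| + 1), by positivity, fun x y hxy => ?_⟩
    apply one_div_le_one_div_of_le hxy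
    have h1 : (∑' y, b x y) / m x ≤ B := hB ⟨x, rfl⟩
    have h2 : m x ≤ M := hM ⟨x, rfl⟩
    have h3 : b x y ≤ ∑' y, b x y := (hb_sum x).le_tsum y (fun z _ => hb_nonneg x z)
    rw [div_le_iff₀ (hm_pos x)] at h1
    have h4 : B * m x ≤ |B| * |M| :=
      mul_le_mul (le_abs_self B) (h2.trans (le_abs_self M)) (hm_pos x).le (abs_nonneg B)
    linarith
  have hsymm := graphDist_comm' b hb_symm
  obtain ⟨f, hf⟩ := exists_injective_nat X
  refine ⟨fun p => {x | (∀ q ∈ D, graphDist b x p ≤ graphDist b x q) ∧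
        (∀ q ∈ D, graphDist b x q = graphDist b x p → f p ≤ f q)}, ?_, ?_, ?_, ?_, ?_⟩
  · intro p hp q hq hpq
    rw [Set.disjoint_left]
    rintro x ⟨h1, h2⟩ ⟨h3, h4⟩
    have he := le_antisymm (h1 q hq) (h3 p hp)
    exact hpq (hf (le_antisymm (h2 q hq he.symm) (h4 p hp he)))
  · intro p hp
    have h0 : graphDist b p p ≤ 0 := by
      have : IsPathFrom b [p] p p := ⟨⟨by simp, List.isChain_singleton p⟩, rfl, rfl⟩
      simpa [pathLength] using graphDist_le b hb_nonneg this
    have hpos : ∀ q, q ≠ p → c ≤ graphDist b p q := by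
      intro q hq
      refine le_graphDist b hconn fun γ hγ => ?_
      match γ, hγ with
      | [], hγ => exact absurd rfl hγ.1.1
      | [a], hγ =>
        have h1 : a = p := by simpa using hγ.2.1
        have h2 : a = q := by simpa using hγ.2.2
        exact absurd (h2.symm.trans h1) hq
      | a :: y :: t, hγ =>
        obtain ⟨rfl, hxy, ht⟩ := isPathFrom_tail hγ
        rw [pathLength]
        have := hcb _ _ hxy
        have := pathLength_nonneg' b hb_nonneg (y :: t)
        linarith
    refine ⟨fun q hq => ?_, fun q hq he => ?_⟩
    · by_cases h : q = p
      · rw [h]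
      · have := hpos q h
        linarith
    · by_cases h : q = p
      · rw [h]
      · have := hpos q h
        linarith
  · rintro p hp x ⟨h1, h2⟩
    obtain ⟨p', hp', γ, hγ, hmin⟩ := exists_min_path b hb_nonneg hb_sum c hc hcb hconn {p}
      (Set.singleton_nonempty p) x
    obtain rfl : p' = p := hp'
    have hL : pathLength b γ = graphDist b x p' :=
      le_antisymm (le_graphDist b hconn (hmin p' rfl)) (graphDist_le b hb_nonneg hγ)
    refine ⟨γ.reverse, isPathFrom_rev hb_symm hγ, ?_, ?_⟩
    · intro z hz
      exact cell_path b hb_nonneg hconn D f p' γ x hγ hL h1 h2 z (List.mem_reverse.1 hz)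
    · rw [pathLength_rev b hb_symm, hL, hsymm]
  · rintro p hp x ⟨h1, h2⟩ q hq
    rw [hsymm p, hsymm q]
    exact h1 q hq
  · refine Set.eq_univ_of_forall fun x => ?_
    obtain ⟨p, hp, γ, hγ, hmin⟩ := exists_min_path b hb_nonneg hb_sum c hc hcb hconn D hD x
    have hmp : ∀ q ∈ D, graphDist b x p ≤ graphDist b x q := fun q hq =>
      (graphDist_le b hb_nonneg hγ).trans (le_graphDist b hconn (hmin q hq))
    let S : Set X := {q | q ∈ D ∧ graphDist b x q = graphDist b x p}
    have hS : S.Nonempty := ⟨p, hp, rfl⟩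
    obtain ⟨r, ⟨hrD, hr⟩, hrmin⟩ : ∃ r ∈ S, ∀ q ∈ S, f r ≤ f q :=
      ⟨Function.argminOn f S hS, Function.argminOn_mem f S hS,
        fun q hq => Function.argminOn_le f S hq⟩
    simp only [Set.mem_iUnion]
    refine ⟨r, hrD, fun q hq => hr ▸ hmp q hq, fun q hq he => hrmin q ⟨hq, he.trans hr⟩⟩
end
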